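/- No element of SYT((∞^∞)) is periodic: there is no T ∈ SYT((∞^∞)) and k ≥ 1 with jdt^k(T) = T. -/

import Mathlib

open scoped Classical

/-- A 0-based box `(i, j)` belongs to the infinite shape with `l` rows
(`l = ⊤` gives the shape `(∞^∞)`, `l = (l₀ : ℕ∞)` gives `(∞^l₀)`).
Throughout, boxes are 0-based: the paper's box `(i, j)` (with row `i ≥ 1` and
column `j ≥ 1`) corresponds to `(i - 1, j - 1)`. -/
def Box (l : ℕ∞) (b : ℕ × ℕ) : Prop := (b.1 : ℕ∞) < l

/-- `T` is an infinite standard Young tableau of the shape given by `Box l`: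
entries are positive integers on the shape (and the junk value `0` off the shape),
`T` is a bijection from the boxes of the shape onto the positive integers, and
`T` is strictly increasing along rows and columns. -/
structure IsSYT (l : ℕ∞) (T : ℕ × ℕ → ℕ) : Prop where
  zero_outside : ∀ b : ℕ × ℕ, ¬ Box l b → T b = 0
  pos : ∀ b : ℕ × ℕ, Box l b → 0 < T b
  inj : ∀ b c : ℕ × ℕ, Box l b → Box l c → T b = T c → b = c
  surj : ∀ n : ℕ, 0 < n → ∃ b : ℕ × ℕ, Box l b ∧ T b = n
  row_lt : ∀ b : ℕ × ℕ, Box l b → T b < T (b.1, b.2 + 1)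
  col_lt : ∀ b : ℕ × ℕ, Box l (b.1 + 1, b.2) → T b < T (b.1 + 1, b.2)

/-- The sliding path of the filling `T` inside the set `D` of boxes, started at the
box `c`: at each step the empty box moves to whichever of the boxes directly below
or directly to the right (among those belonging to `D`) carries the smaller entry;
if neither belongs to `D`, the path stays put (it has terminated). -/
noncomputable def slideFrom (D : ℕ × ℕ → Prop) (T : ℕ × ℕ → ℕ) (c : ℕ × ℕ) : ℕ → ℕ × ℕ
  | 0 => c
  | n + 1 =>
      let b := slideFrom D T c n
      if D (b.1 + 1, b.2) ∧ D (b.1, b.2 + 1) then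
        (if T (b.1 + 1, b.2) < T (b.1, b.2 + 1) then (b.1 + 1, b.2) else (b.1, b.2 + 1))
      else if D (b.1 + 1, b.2) then (b.1 + 1, b.2)
      else if D (b.1, b.2 + 1) then (b.1, b.2 + 1)
      else b

/-- The sliding path `p(T)`, 0-indexed: `slide D T n` is the paper's `p_{n+1}(T)`;
it lies on the antidiagonal `i + j = n` as long as the path has not terminated. -/
noncomputable def slide (D : ℕ × ℕ → Prop) (T : ℕ × ℕ → ℕ) : ℕ → ℕ × ℕ :=
  slideFrom D T (0, 0)

/-- Jeu de taquin on the set of boxes `D`: the entry `1` in the box `(0,0)` is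
deleted, entries slide backwards along the sliding path, and every entry is
decremented by `1`.  A box `b` lies on the sliding path iff
`slide D T (b.1 + b.2) = b`; if moreover the path terminates at `b` (which is only
possible for finite tableaux) the box `b` is vacated (junk value `0`). -/
noncomputable def jdt (D : ℕ × ℕ → Prop) (T : ℕ × ℕ → ℕ) : ℕ × ℕ → ℕ := fun b =>
  if slide D T (b.1 + b.2) = b then
    (if slide D T (b.1 + b.2 + 1) = b then 0
     else T (slide D T (b.1 + b.2 + 1)) - 1)
  else T b - 1

theorem aux_step (T : ℕ × ℕ → ℕ) (c : ℕ × ℕ) :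
    ∃ b, c ≤ b ∧ jdt (Box (⊤ : ℕ∞)) T c = T b - 1 := by
  have hB : ∀ b, Box (⊤ : ℕ∞) b := fun b => ENat.natCast_lt_top _
  by_cases h : slide (Box (⊤ : ℕ∞)) T (c.1 + c.2) = c
  · have hs : slide (Box (⊤ : ℕ∞)) T (c.1 + c.2 + 1) = (c.1 + 1, c.2) ∨
        slide (Box (⊤ : ℕ∞)) T (c.1 + c.2 + 1) = (c.1, c.2 + 1) := by
      unfold slide at h ⊢
      rw [slideFrom, h]
      simp only [hB, and_self, if_true]
      split_ifs <;> simp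
    refine ⟨slide (Box (⊤ : ℕ∞)) T (c.1 + c.2 + 1), ?_, ?_⟩
    · rcases hs with hs | hs <;> rw [hs] <;> constructor <;> simp
    · have hne : slide (Box (⊤ : ℕ∞)) T (c.1 + c.2 + 1) ≠ c := by
        rcases hs with hs | hs <;> rw [hs] <;> intro e <;>
          have := congrArg (fun x : ℕ × ℕ => x.1 + x.2) e <;> simp at this <;> omega
      simp only [jdt, if_pos h, if_neg hne]
  · exact ⟨c, le_rfl, by simp only [jdt, if_neg h]⟩

theorem aux_iter (T : ℕ × ℕ → ℕ) (j : ℕ) : ∀ c : ℕ × ℕ,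
    ∃ b, c ≤ b ∧ (jdt (Box (⊤ : ℕ∞)))^[j] T c = T b - j := by
  induction j with
  | zero => exact fun c => ⟨c, le_rfl, rfl⟩
  | succ j ih =>
    intro c
    rw [Function.iterate_succ_apply']
    obtain ⟨b, hb, e⟩ := aux_step ((jdt (Box (⊤ : ℕ∞)))^[j] T) c
    obtain ⟨d, hd, e'⟩ := ih b
    exact ⟨d, hb.trans hd, by rw [e, e']; omega⟩

/-- No element of `SYT((∞^∞))` is periodic. -/
theorem stmt_9 :
    ¬ ∃ (T : ℕ × ℕ → ℕ) (k : ℕ), IsSYT (⊤ : ℕ∞) T ∧ 1 ≤ k ∧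
      (jdt (Box (⊤ : ℕ∞)))^[k] T = T := by
  rintro ⟨T, k, hT, hk, hper⟩
  have hB : ∀ b, Box (⊤ : ℕ∞) b := fun b => ENat.natCast_lt_top _
  have h1 : ∀ c, ∃ b, c ≤ b ∧ T b = T c + k := by
    intro c
    obtain ⟨b, hb, e⟩ := aux_iter T k c
    rw [hper] at e
    have := hT.pos c (hB c)
    exact ⟨b, hb, by omega⟩
  have h2 : ∀ n c, ∃ b, c ≤ b ∧ T b = T c + k * n := by
    intro n
    induction n with
    | zero => exact fun c => ⟨c, le_rfl, rfl⟩
    | succ n ih =>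
      intro c
      obtain ⟨b, hb, e⟩ := ih c
      obtain ⟨d, hd, e'⟩ := h1 b
      exact ⟨d, hb.trans hd, by rw [e', e]; ring⟩
  have h3 : ∀ c d, T c % k = T d % k → T c ≤ T d → c ≤ d := by
    intro c d hm hle
    obtain ⟨n, hn⟩ := (Nat.modEq_iff_dvd' hle).1 hm
    obtain ⟨b, hb, e⟩ := h2 n c
    have : b = d := hT.inj b d (hB b) (hB d) (by omega)
    exact this ▸ hb
  obtain ⟨x, hx, y, hy, hxy, he⟩ := Finset.exists_ne_map_eq_of_card_lt_of_maps_to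
    (s := Finset.range (k + 1)) (t := Finset.range k) (by simp)
    (f := fun i => T (i, k - i) % k)
    (fun i _ => by simpa using Nat.mod_lt _ hk)
  simp only [Finset.mem_range] at hx hy he
  rcases le_total (T (x, k - x)) (T (y, k - y)) with h | h
  · have := h3 _ _ he h
    rw [Prod.mk_le_mk] at this
    omega
  · have := h3 _ _ he.symm h
    rw [Prod.mk_le_mk] at this
    omega
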